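/- arXiv:math/9909012 — 4 statements merged into one kernel-verified Lean document; each statement's English description precedes it below -/
import Mathlib

section
/- Let C₀ ≥ 1 and b > 0, and let T : ℝ² → ℝ² be of the form T(x,y) = (f(x,y), b·g(x,y)) where f, g are C² functions all of whose first and second order partial derivatives are bounded in absolute value by C₀. Then there exists K ≥ 1, depending only on C₀, such that for every twice differentiable curve γ : ℝ → ℝ² with γ′(s) ≠ 0 and DT(γ(s))γ′(s) ≠ 0, the curvature k_{T∘γ}(s) of the image curve satisfies k_{T∘γ}(s) ≤ (K b · k_γ(s) + K b) · ‖γ′(s)‖³ / ‖(T∘γ)′(s)‖³, where k_γ(s) := |γ′(s) × γ″(s)| / ‖γ′(s)‖³ denotes the curvature of γ at s. -/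
/-- The planar cross product `u × v = u₁ v₂ − u₂ v₁` on `ℝ²`. -/
def crossP (u v : ℝ × ℝ) : ℝ := u.1 * v.2 - u.2 * v.1

/-- The Euclidean norm on `ℝ²` (as pairs). -/
noncomputable def enormP (p : ℝ × ℝ) : ℝ := Real.sqrt (p.1 ^ 2 + p.2 ^ 2)

/-- The curvature `|γ′ × γ″| / ‖γ′‖³` of a planar curve. -/
noncomputable def curvP (γ : ℝ → ℝ × ℝ) (s : ℝ) : ℝ :=
  |crossP (deriv γ s) (deriv (deriv γ) s)| / enormP (deriv γ s) ^ 3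

theorem hasDerivAt_comp_curve {f : ℝ × ℝ → ℝ} (hf : ContDiff ℝ 2 f) {γ : ℝ → ℝ × ℝ}
    (hγ : Differentiable ℝ γ) (t : ℝ) :
    HasDerivAt (fun t => f (γ t)) (fderiv ℝ f (γ t) (deriv γ t)) t :=
  ((hf.differentiable (by norm_num)) (γ t)).hasFDerivAt.comp_hasDerivAt t (hγ t).hasDerivAt

theorem hasDerivAt_fderiv_comp_curve {f : ℝ × ℝ → ℝ} (hf : ContDiff ℝ 2 f) {γ : ℝ → ℝ × ℝ}
    (hγ : Differentiable ℝ γ) (hγ' : Differentiable ℝ (deriv γ)) (t : ℝ) :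
    HasDerivAt (fun t => fderiv ℝ f (γ t) (deriv γ t))
      (fderiv ℝ (fderiv ℝ f) (γ t) (deriv γ t) (deriv γ t) +
        fderiv ℝ f (γ t) (deriv (deriv γ) t)) t := by
  have hf' : Differentiable ℝ (fderiv ℝ f) :=
    (hf.fderiv_right (m := 1) (by norm_num)).differentiable (by norm_num)
  exact ((hf' (γ t)).hasFDerivAt.comp_hasDerivAt t (hγ t).hasDerivAt).clm_apply
    (hγ' t).hasDerivAt

theorem prod_eq_smul_basis (w : ℝ × ℝ) : w = w.1 • ((1, 0) : ℝ × ℝ) + w.2 • ((0, 1) : ℝ × ℝ) := by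
  ext <;> simp

theorem clm_apply_eq_coords {E : Type*} [NormedAddCommGroup E] [NormedSpace ℝ E]
    (L : ℝ × ℝ →L[ℝ] E) (w : ℝ × ℝ) : L w = w.1 • L (1, 0) + w.2 • L (0, 1) := by
  conv_lhs => rw [prod_eq_smul_basis w]
  simp only [map_add, map_smul]

theorem abs_clm_apply_le {C : ℝ} (L : ℝ × ℝ →L[ℝ] ℝ)
    (hL₁ : |L (1, 0)| ≤ C) (hL₂ : |L (0, 1)| ≤ C) (w : ℝ × ℝ) :
    |L w| ≤ C * (|w.1| + |w.2|) := by
  rw [clm_apply_eq_coords L w, smul_eq_mul, smul_eq_mul]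
  calc |w.1 * L (1, 0) + w.2 * L (0, 1)| ≤ |w.1| * |L (1, 0)| + |w.2| * |L (0, 1)| := by
        simpa only [abs_mul] using abs_add_le (w.1 * L (1, 0)) (w.2 * L (0, 1))
    _ ≤ |w.1| * C + |w.2| * C := by gcongr
    _ = C * (|w.1| + |w.2|) := by ring

theorem abs_bilinear_diag_le {C : ℝ} (B : ℝ × ℝ →L[ℝ] ℝ × ℝ →L[ℝ] ℝ)
    (hB : ∀ u ∈ ({(1, 0), (0, 1)} : Set (ℝ × ℝ)), ∀ v ∈ ({(1, 0), (0, 1)} : Set (ℝ × ℝ)),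
      |B u v| ≤ C) (w : ℝ × ℝ) :
    |B w w| ≤ C * (|w.1| + |w.2|) ^ 2 := by
  have hcol : ∀ v ∈ ({(1, 0), (0, 1)} : Set (ℝ × ℝ)), |B w v| ≤ C * (|w.1| + |w.2|) :=
    fun v hv => abs_clm_apply_le (B.flip v) (hB _ (by simp) v hv) (hB _ (by simp) v hv) w
  calc |B w w| ≤ C * (|w.1| + |w.2|) * (|w.1| + |w.2|) :=
        abs_clm_apply_le (B w) (hcol _ (by simp)) (hcol _ (by simp)) w
    _ = C * (|w.1| + |w.2|) ^ 2 := by ring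

theorem abs_crossP_apply_le {C : ℝ} (L M : ℝ × ℝ →L[ℝ] ℝ)
    (hL₁ : |L (1, 0)| ≤ C) (hL₂ : |L (0, 1)| ≤ C) (hM₁ : |M (1, 0)| ≤ C) (hM₂ : |M (0, 1)| ≤ C)
    (w a : ℝ × ℝ) :
    |L w * M a - M w * L a| ≤ 2 * C ^ 2 * |crossP w a| := by
  have hC : 0 ≤ C := (abs_nonneg _).trans hL₁
  have hdet : L w * M a - M w * L a =
      (L (1, 0) * M (0, 1) - L (0, 1) * M (1, 0)) * crossP w a := by
    rw [clm_apply_eq_coords L w, clm_apply_eq_coords L a, clm_apply_eq_coords M w,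
      clm_apply_eq_coords M a]
    simp only [smul_eq_mul, crossP]
    ring
  rw [hdet, abs_mul]
  gcongr
  calc |L (1, 0) * M (0, 1) - L (0, 1) * M (1, 0)|
      ≤ |L (1, 0)| * |M (0, 1)| + |L (0, 1)| * |M (1, 0)| := by
        simpa only [abs_mul] using abs_sub (L (1, 0) * M (0, 1)) (L (0, 1) * M (1, 0))
    _ ≤ C * C + C * C := by gcongr
    _ = 2 * C ^ 2 := by ring

theorem abs_add_abs_le_two_mul_enormP (w : ℝ × ℝ) : |w.1| + |w.2| ≤ 2 * enormP w := by
  have h₁ : |w.1| ≤ enormP w := Real.abs_le_sqrt (by nlinarith [sq_nonneg w.2])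
  have h₂ : |w.2| ≤ enormP w := Real.abs_le_sqrt (by nlinarith [sq_nonneg w.1])
  linarith

theorem enormP_pos {w : ℝ × ℝ} (hw : w ≠ 0) : 0 < enormP w := by
  refine Real.sqrt_pos.2 ?_
  by_contra! h
  refine hw (Prod.ext ?_ ?_) <;> simp only [Prod.fst_zero, Prod.snd_zero] <;>
    nlinarith [sq_nonneg w.1, sq_nonneg w.2]

/-- Lemma 2.4 (curvature estimate): for `T(x,y) = (f(x,y), b g(x,y))` with `f, g`
having all first and second partial derivatives bounded by `C₀`,
`k_{T∘γ}(s) ≤ (K b k_γ(s) + K b) ‖γ′(s)‖³ / ‖(T∘γ)′(s)‖³`. -/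
theorem stmt11 :
    ∀ C₀ : ℝ, 1 ≤ C₀ → ∃ K : ℝ, 1 ≤ K ∧
      ∀ b : ℝ, 0 < b →
      ∀ f g : ℝ × ℝ → ℝ, ContDiff ℝ 2 f → ContDiff ℝ 2 g →
        (∀ z : ℝ × ℝ, ∀ u ∈ ({(1, 0), (0, 1)} : Set (ℝ × ℝ)),
          |fderiv ℝ f z u| ≤ C₀ ∧ |fderiv ℝ g z u| ≤ C₀ ∧
          ∀ v ∈ ({(1, 0), (0, 1)} : Set (ℝ × ℝ)),
            |fderiv ℝ (fderiv ℝ f) z u v| ≤ C₀ ∧ |fderiv ℝ (fderiv ℝ g) z u v| ≤ C₀) →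
      ∀ γ : ℝ → ℝ × ℝ, Differentiable ℝ γ → Differentiable ℝ (deriv γ) →
      ∀ s : ℝ, deriv γ s ≠ 0 →
        fderiv ℝ (fun p => (f p, b * g p)) (γ s) (deriv γ s) ≠ 0 →
        curvP (fun t => (f (γ t), b * g (γ t))) s ≤
          (K * b * curvP γ s + K * b) * enormP (deriv γ s) ^ 3 /
            enormP (deriv (fun t => (f (γ t), b * g (γ t))) s) ^ 3 := by
  intro C₀ hC
  have hC0 : 0 ≤ C₀ := by linarith
  refine ⟨16 * C₀ ^ 2, by nlinarith, ?_⟩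
  intro b hb f g hf hg hbound γ hγ hγ' s hs _
  have hderiv : deriv (fun t => (f (γ t), b * g (γ t))) =
      fun t => (fderiv ℝ f (γ t) (deriv γ t), b * fderiv ℝ g (γ t) (deriv γ t)) :=
    funext fun t => ((hasDerivAt_comp_curve hf hγ t).prodMk
      ((hasDerivAt_comp_curve hg hγ t).const_mul b)).deriv
  have hderiv₂ := ((hasDerivAt_fderiv_comp_curve hf hγ hγ' s).prodMk
    ((hasDerivAt_fderiv_comp_curve hg hγ hγ' s).const_mul b)).deriv
  have hpos : 0 < enormP (deriv γ s) := enormP_pos hs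
  have hcurv : curvP γ s * enormP (deriv γ s) ^ 3 =
      |crossP (deriv γ s) (deriv (deriv γ) s)| :=
    div_mul_cancel₀ _ (pow_pos hpos 3).ne'
  rw [curvP.eq_def (fun t => (f (γ t), b * g (γ t)))]
  refine div_le_div_of_nonneg_right ?_ (pow_nonneg (Real.sqrt_nonneg _) 3)
  rw [hderiv, hderiv₂]
  have hf₁ := (hbound (γ s) (1, 0) (by simp)).1
  have hf₂ := (hbound (γ s) (0, 1) (by simp)).1
  have hg₁ := (hbound (γ s) (1, 0) (by simp)).2.1
  have hg₂ := (hbound (γ s) (0, 1) (by simp)).2.1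
  have hff := abs_bilinear_diag_le (fderiv ℝ (fderiv ℝ f) (γ s))
    (fun u hu v hv => ((hbound (γ s) u hu).2.2 v hv).1) (deriv γ s)
  have hgg := abs_bilinear_diag_le (fderiv ℝ (fderiv ℝ g) (γ s))
    (fun u hu v hv => ((hbound (γ s) u hu).2.2 v hv).2) (deriv γ s)
  have hfw := abs_clm_apply_le _ hf₁ hf₂ (deriv γ s)
  have hgw := abs_clm_apply_le _ hg₁ hg₂ (deriv γ s)
  have hcross := abs_crossP_apply_le _ _ hf₁ hf₂ hg₁ hg₂ (deriv γ s) (deriv (deriv γ) s)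
  have hr := abs_add_abs_le_two_mul_enormP (deriv γ s)
  have hr0 : 0 ≤ |(deriv γ s).1| + |(deriv γ s).2| := by positivity
  set w := deriv γ s
  set a := deriv (deriv γ) s
  set L := fderiv ℝ f (γ s)
  set M := fderiv ℝ g (γ s)
  set P := fderiv ℝ (fderiv ℝ f) (γ s) w w
  set Q := fderiv ℝ (fderiv ℝ g) (γ s) w w
  set r := |w.1| + |w.2|
  have hexpand : crossP (L w, b * M w) (P + L a, b * (Q + M a)) =
      b * ((L w * M a - M w * L a) + (L w * Q - M w * P)) := by
    simp only [crossP]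
    ring
  have hquad : |L w * Q - M w * P| ≤ 2 * C₀ ^ 2 * r ^ 3 := by
    calc |L w * Q - M w * P| ≤ |L w| * |Q| + |M w| * |P| := by
          simpa only [abs_mul] using abs_sub (L w * Q) (M w * P)
      _ ≤ (C₀ * r) * (C₀ * r ^ 2) + (C₀ * r) * (C₀ * r ^ 2) := by gcongr
      _ = 2 * C₀ ^ 2 * r ^ 3 := by ring
  rw [hexpand, abs_mul, abs_of_pos hb]
  calc b * |(L w * M a - M w * L a) + (L w * Q - M w * P)|
      ≤ b * (2 * C₀ ^ 2 * |crossP w a| + 2 * C₀ ^ 2 * r ^ 3) := by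
        gcongr
        exact (abs_add_le _ _).trans (add_le_add hcross hquad)
    _ ≤ b * (16 * C₀ ^ 2 * |crossP w a| + 2 * C₀ ^ 2 * (2 * enormP w) ^ 3) := by
        gcongr
        norm_num
    _ = (16 * C₀ ^ 2 * b * curvP γ s + 16 * C₀ ^ 2 * b) * enormP w ^ 3 := by
        rw [← hcurv]
        ring
end

section
/- (Hadamard) Let L, M₀, M₂ > 0 with 4M₀ < L², and let g : (0, L) → ℝ be twice differentiable with |g(x)| ≤ M₀ and |g″(x)| ≤ M₂ for all x ∈ (0, L). Then |g′(x)| ≤ √M₀ · (1 + M₂) for all x ∈ (0, L). -/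
/-- A function on a convex set of reals with second derivative at least `-M` lies above
the parabola of leading coefficient `-M / 2` tangent to its graph. -/
lemma tangent_parabola_le_of_neg_le_deriv2 {s : Set ℝ} (hs : Convex ℝ s)
    {f : ℝ → ℝ} {M : ℝ} (hf : ∀ x ∈ s, DifferentiableAt ℝ f x)
    (hf' : ∀ x ∈ s, DifferentiableAt ℝ (deriv f) x)
    (hM : ∀ x ∈ s, -M ≤ deriv (deriv f) x) {x y : ℝ} (hx : x ∈ s) (hy : y ∈ s) :
    f x + deriv f x * (y - x) - M / 2 * (y - x) ^ 2 ≤ f y := by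
  have hφ : ∀ t ∈ s, HasDerivAt (fun t => f t + M / 2 * t ^ 2) (deriv f t + M * t) t := by
    intro t ht
    refine ((hf t ht).hasDerivAt.fun_add
      ((hasDerivAt_pow 2 t).const_mul (M / 2))).congr_deriv ?_
    push_cast
    ring
  have hφ' : ∀ t ∈ s, HasDerivAt (fun t => deriv f t + M * t) (deriv (deriv f) t + M) t := by
    intro t ht
    simpa using (hf' t ht).hasDerivAt.fun_add ((hasDerivAt_id' t).const_mul M)
  have hconv : ConvexOn ℝ s (fun t => f t + M / 2 * t ^ 2) := by
    apply convexOn_of_hasDerivWithinAt2_nonneg hs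
      (fun t ht => (hφ t ht).continuousAt.continuousWithinAt)
      (f' := fun t => deriv f t + M * t) (f'' := fun t => deriv (deriv f) t + M)
    · exact fun t ht => (hφ t (interior_subset ht)).hasDerivWithinAt
    · exact fun t ht => (hφ' t (interior_subset ht)).hasDerivWithinAt
    · exact fun t ht => by linarith [hM t (interior_subset ht)]
  rcases lt_trichotomy x y with h | rfl | h
  · have := hconv.le_slope_of_hasDerivAt hx hy h (hφ x hx)
    rw [slope_def_field, le_div_iff₀ (sub_pos.2 h)] at this
    linarith
  · simp
  · have := hconv.slope_le_of_hasDerivAt hy hx h (hφ x hx)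
    rw [slope_def_field, div_le_iff₀ (sub_pos.2 h)] at this
    linarith

/-- The first-order Taylor estimate under a pointwise bound on the second derivative. -/
lemma abs_sub_tangent_le_of_abs_deriv2_le {s : Set ℝ} (hs : Convex ℝ s)
    {f : ℝ → ℝ} {M : ℝ} (hf : ∀ x ∈ s, DifferentiableAt ℝ f x)
    (hf' : ∀ x ∈ s, DifferentiableAt ℝ (deriv f) x)
    (hM : ∀ x ∈ s, |deriv (deriv f) x| ≤ M) {x y : ℝ} (hx : x ∈ s) (hy : y ∈ s) :
    |f y - f x - deriv f x * (y - x)| ≤ M / 2 * (y - x) ^ 2 := by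
  have hneg : deriv (-f) = -deriv f := deriv.neg'
  have hneg2 : deriv (-deriv f) = -deriv (deriv f) := deriv.neg'
  have h₁ := tangent_parabola_le_of_neg_le_deriv2 hs hf hf'
    (fun t ht => (abs_le.1 (hM t ht)).1) hx hy
  have h₂ := tangent_parabola_le_of_neg_le_deriv2 (f := -f) (M := M) hs
    (fun t ht => (hf t ht).neg) (fun t ht => by rw [hneg]; exact (hf' t ht).neg)
    (fun t ht => by
      rw [hneg, hneg2]
      exact neg_le_neg (abs_le.1 (hM t ht)).2) hx hy
  rw [hneg] at h₂
  simp only [Pi.neg_apply] at h₂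
  rw [abs_le]
  constructor <;> linarith

/-- Hadamard's lemma: if `g : (0, L) → ℝ` is twice differentiable with `|g| ≤ M₀` and
`|g″| ≤ M₂` on `(0, L)`, and `4 M₀ < L²`, then `|g′| ≤ √M₀ (1 + M₂)` on `(0, L)`. -/
theorem stmt12 (L M₀ M₂ : ℝ) (hL : 0 < L) (hM₀ : 0 < M₀) (hM₂ : 0 < M₂)
    (hLM : 4 * M₀ < L ^ 2) (g : ℝ → ℝ)
    (hg : ∀ x ∈ Set.Ioo (0 : ℝ) L, DifferentiableAt ℝ g x)
    (hg' : ∀ x ∈ Set.Ioo (0 : ℝ) L, DifferentiableAt ℝ (deriv g) x)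
    (hgb : ∀ x ∈ Set.Ioo (0 : ℝ) L, |g x| ≤ M₀)
    (hg''b : ∀ x ∈ Set.Ioo (0 : ℝ) L, |deriv (deriv g) x| ≤ M₂) :
    ∀ x ∈ Set.Ioo (0 : ℝ) L, |deriv g x| ≤ Real.sqrt M₀ * (1 + M₂) := by
  intro x hx
  set r := Real.sqrt M₀
  have hr : 0 < r := Real.sqrt_pos.2 hM₀
  have hr2 : r ^ 2 = M₀ := Real.sq_sqrt hM₀.le
  have hrL : 2 * r < L := by nlinarith
  obtain ⟨a, b, ha, hb, hab, hxa, hxb⟩ :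
      ∃ a b : ℝ, 0 ≤ a ∧ 0 ≤ b ∧ a + b = 2 * r ∧ 0 < x - a ∧ x + b < L := by
    have hq : 2 * r / L < 1 := (div_lt_one hL).2 hrL
    have hqL : 2 * r / L * L = 2 * r := div_mul_cancel₀ _ hL.ne'
    have hq0 : 0 < 2 * r / L := by positivity
    refine ⟨2 * r / L * x, 2 * r / L * (L - x), ?_, ?_, ?_, ?_, ?_⟩ <;>
      nlinarith [hx.1, hx.2]
  have hc : x - a ∈ Set.Ioo 0 L := ⟨hxa, by linarith [hx.2]⟩
  have hd : x + b ∈ Set.Ioo 0 L := ⟨by linarith [hx.1], hxb⟩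
  have hTc := abs_le.1 <|
    abs_sub_tangent_le_of_abs_deriv2_le (convex_Ioo 0 L) hg hg' hg''b hx hc
  have hTd := abs_le.1 <|
    abs_sub_tangent_le_of_abs_deriv2_le (convex_Ioo 0 L) hg hg' hg''b hx hd
  have hgc := abs_le.1 (hgb _ hc)
  have hgd := abs_le.1 (hgb _ hd)
  have hsq : M₂ / 2 * (a ^ 2 + b ^ 2) ≤ 2 * M₂ * r ^ 2 := by
    have : a ^ 2 + b ^ 2 ≤ 4 * r ^ 2 := by nlinarith [mul_nonneg ha hb]
    nlinarith
  have hmul : deriv g x * a + deriv g x * b = 2 * r * deriv g x := by rw [← hab]; ring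
  ring_nf at hTc hTd hsq hmul
  rw [abs_le]
  constructor <;> refine le_of_mul_le_mul_left ?_ (mul_pos two_pos hr) <;> nlinarith
end

section
/- Let C₀ ≥ 1 and c₀ ∈ (0,1]. There exist K ≥ 1, b₀ > 0, and δ₀ > 0, depending only on C₀ and c₀, with the following property. Let F, u, v : ℝ² → ℝ be C² functions all of whose partial derivatives up to order 2 are bounded in absolute value by C₀, let 0 < b < b₀, and define T(x,y) = (F(x,y) + b·u(x,y), b·v(x,y)), so that the Jacobian is DT = [[A, C],[B, D]] with A = F_x + b u_x, C = F_y + b u_y, B = b v_x, D = b v_y. Let z ∈ ℝ² be a point with |F_y(z)| ≥ c₀, |F_{xx}(z)| ≥ c₀, and |F_x(z)| ≤ δ for some δ ≤ δ₀. Then the slope of the most contracted direction of DT, given by q₁(x,y) = (AC + BD) / (C² + D² − λ_min(DT)²), is well defined in a neighborhood of z (the denominator being ≥ 1/K), is differentiable in x there, and satisfies |∂_x q₁(z)| ≥ 1/K. -/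
/-- The Euclidean norm of a vector in `ℝ²`. -/
noncomputable def enorm2 (v : Fin 2 → ℝ) : ℝ := Real.sqrt (v 0 ^ 2 + v 1 ^ 2)

/-- The smallest singular value of a real 2×2 matrix. -/
noncomputable def lamMin2 (M : Matrix (Fin 2) (Fin 2) ℝ) : ℝ :=
  sInf {r : ℝ | ∃ v : Fin 2 → ℝ, enorm2 v = 1 ∧ r = enorm2 (M.mulVec v)}

/-- The Jacobian matrix `DT = [[A, C], [B, D]]` of the map
`T(x,y) = (F(x,y) + b u(x,y), b v(x,y))`, with
`A = F_x + b u_x`, `C = F_y + b u_y`, `B = b v_x`, `D = b v_y`. -/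
noncomputable def DTmat (F u v : ℝ × ℝ → ℝ) (b : ℝ) (z : ℝ × ℝ) :
    Matrix (Fin 2) (Fin 2) ℝ :=
  !![fderiv ℝ F z (1, 0) + b * fderiv ℝ u z (1, 0),
     fderiv ℝ F z (0, 1) + b * fderiv ℝ u z (0, 1);
     b * fderiv ℝ v z (1, 0), b * fderiv ℝ v z (0, 1)]

/-- The slope `q₁ = (AC + BD) / (C² + D² − λ_min(DT)²)` of the most contracted
direction of `DT`. -/
noncomputable def slopeQ (F u v : ℝ × ℝ → ℝ) (b : ℝ) (z : ℝ × ℝ) : ℝ :=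
  (DTmat F u v b z 0 0 * DTmat F u v b z 0 1 +
      DTmat F u v b z 1 0 * DTmat F u v b z 1 1) /
    (DTmat F u v b z 0 1 ^ 2 + DTmat F u v b z 1 1 ^ 2 - lamMin2 (DTmat F u v b z) ^ 2)

theorem lamMin2_of_sq (A B C D : ℝ) :
    lamMin2 !![A, C; B, D] ^ 2 = (A ^ 2 + B ^ 2 + C ^ 2 + D ^ 2 -
      √((C ^ 2 + D ^ 2 - A ^ 2 - B ^ 2) ^ 2 + 4 * (A * C + B * D) ^ 2)) / 2 := by
  set m := A * C + B * D with hm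
  set s := C ^ 2 + D ^ 2 - A ^ 2 - B ^ 2 with hs
  set R := √(s ^ 2 + 4 * m ^ 2) with hR
  have hR2 : R ^ 2 = s ^ 2 + 4 * m ^ 2 := Real.sq_sqrt (by positivity)
  have hRs : |s| ≤ R := Real.abs_le_sqrt (by nlinarith [sq_nonneg m])
  obtain ⟨hs1, hs2⟩ := abs_le.1 hRs
  set L := (A ^ 2 + B ^ 2 + C ^ 2 + D ^ 2 - R) / 2 with hL
  set p := (R - s) / 2 with hp
  set r := (R + s) / 2 with hr
  have hp0 : 0 ≤ p := by linarith
  have hr0 : 0 ≤ r := by linarith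
  have hpr : p * r = m ^ 2 := by rw [hp, hr]; linarith
  have key (x y : ℝ) : (A * x + C * y) ^ 2 + (B * x + D * y) ^ 2 =
      L * (x ^ 2 + y ^ 2) + (p * x ^ 2 + 2 * m * x * y + r * y ^ 2) := by
    rw [hp, hr, hL, hs, hm]; ring
  have hform (x y : ℝ) : 0 ≤ p * x ^ 2 + 2 * m * x * y + r * y ^ 2 := by
    rcases hr0.eq_or_lt with h | h
    · have : m = 0 := by rw [← h, mul_zero] at hpr; exact pow_eq_zero_iff two_ne_zero |>.1 hpr.symm
      rw [this, ← h]; nlinarith [mul_nonneg hp0 (sq_nonneg x)]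
    · have : 0 ≤ r * (p * x ^ 2 + 2 * m * x * y + r * y ^ 2) := by
        have e : r * (p * x ^ 2 + 2 * m * x * y + r * y ^ 2) = (m * x + r * y) ^ 2 := by
          linear_combination x ^ 2 * hpr
        rw [e]; positivity
      exact nonneg_of_mul_nonneg_right this h
  have hnorm (w : Fin 2 → ℝ) : enorm2 ((!![A, C; B, D] : Matrix (Fin 2) (Fin 2) ℝ).mulVec w) =
      √((A * w 0 + C * w 1) ^ 2 + (B * w 0 + D * w 1) ^ 2) := by
    simp [enorm2, Matrix.mulVec, dotProduct, Fin.sum_univ_two]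
  have hexists : ∃ x y : ℝ, x ^ 2 + y ^ 2 = 1 ∧ p * x ^ 2 + 2 * m * x * y + r * y ^ 2 = 0 := by
    rcases hr0.eq_or_lt with h | h
    · exact ⟨0, 1, by norm_num, by rw [← h]; ring⟩
    · have hN : 0 < r ^ 2 + m ^ 2 := by positivity
      have hN2 : √(r ^ 2 + m ^ 2) ^ 2 = r ^ 2 + m ^ 2 := Real.sq_sqrt hN.le
      have hN0 : √(r ^ 2 + m ^ 2) ≠ 0 := (Real.sqrt_pos.2 hN).ne'
      generalize √(r ^ 2 + m ^ 2) = N at hN2 hN0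
      clear_value r p m
      refine ⟨r / N, -m / N, ?_, ?_⟩
      · field_simp
        linear_combination -hN2
      · field_simp
        linear_combination r * hpr
  have hleast : IsLeast {t : ℝ | ∃ w : Fin 2 → ℝ, enorm2 w = 1 ∧
      t = enorm2 ((!![A, C; B, D] : Matrix (Fin 2) (Fin 2) ℝ).mulVec w)} (√L) := by
    constructor
    · obtain ⟨x, y, h1, h2⟩ := hexists
      refine ⟨![x, y], by simp [enorm2, h1], ?_⟩
      rw [hnorm]
      simp [key, h1, h2]
    · rintro t ⟨w, hw, rfl⟩
      have hw1 : w 0 ^ 2 + w 1 ^ 2 = 1 := Real.sqrt_eq_one.1 hw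
      rw [hnorm, key, hw1, mul_one]
      exact Real.sqrt_le_sqrt (by linarith [hform (w 0) (w 1)])
  have hL0 : 0 ≤ L := by
    obtain ⟨x, y, h1, h2⟩ := hexists
    have := key x y
    rw [h1, h2] at this
    nlinarith [sq_nonneg (A * x + C * y), sq_nonneg (B * x + D * y)]
  rw [lamMin2, hleast.csInf_eq, Real.sq_sqrt hL0]

theorem lamMin2_sq (M : Matrix (Fin 2) (Fin 2) ℝ) :
    lamMin2 M ^ 2 = (M 0 0 ^ 2 + M 1 0 ^ 2 + M 0 1 ^ 2 + M 1 1 ^ 2 -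
      √((M 0 1 ^ 2 + M 1 1 ^ 2 - M 0 0 ^ 2 - M 1 0 ^ 2) ^ 2 +
        4 * (M 0 0 * M 0 1 + M 1 0 * M 1 1) ^ 2)) / 2 := by
  conv_lhs => rw [Matrix.eta_fin_two M]
  exact lamMin2_of_sq _ _ _ _

theorem sq_add_sq_sub_lamMin2_sq (M : Matrix (Fin 2) (Fin 2) ℝ) :
    M 0 1 ^ 2 + M 1 1 ^ 2 - lamMin2 M ^ 2 =
      ((M 0 1 ^ 2 + M 1 1 ^ 2 - M 0 0 ^ 2 - M 1 0 ^ 2) +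
        √((M 0 1 ^ 2 + M 1 1 ^ 2 - M 0 0 ^ 2 - M 1 0 ^ 2) ^ 2 +
          4 * (M 0 0 * M 0 1 + M 1 0 * M 1 1) ^ 2)) / 2 := by
  rw [lamMin2_sq]
  ring

/-- The slope of the most contracted direction in terms of the entries of the Gram matrix: `m` is
the off-diagonal entry and `s` the difference of the diagonal entries. -/
noncomputable def gramSlope (m s : ℝ) : ℝ := 2 * m / (s + √(s ^ 2 + 4 * m ^ 2))

theorem abs_le_sqrt_gram (m s : ℝ) : |s| ≤ √(s ^ 2 + 4 * m ^ 2) :=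
  Real.abs_le_sqrt (by nlinarith [sq_nonneg m])

theorem two_mul_mul_gramSlope (m s : ℝ) (hs : 0 < s) :
    2 * m * gramSlope m s + s = √(s ^ 2 + 4 * m ^ 2) := by
  have h2 : √(s ^ 2 + 4 * m ^ 2) ^ 2 = s ^ 2 + 4 * m ^ 2 := Real.sq_sqrt (by positivity)
  have h0 : 0 < s + √(s ^ 2 + 4 * m ^ 2) := by positivity
  rw [gramSlope]
  generalize √(s ^ 2 + 4 * m ^ 2) = R at h2 h0 ⊢
  field_simp
  linear_combination -h2

theorem gramSlope_quadratic (m s : ℝ) :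
    m * gramSlope m s ^ 2 + s * gramSlope m s - m = 0 := by
  have h2 : √(s ^ 2 + 4 * m ^ 2) ^ 2 = s ^ 2 + 4 * m ^ 2 := Real.sq_sqrt (by positivity)
  rw [gramSlope]
  generalize √(s ^ 2 + 4 * m ^ 2) = R at h2 ⊢
  by_cases h : s + R = 0
  · have : m = 0 := by
      have e : R = -s := by linarith
      rw [e] at h2
      exact pow_eq_zero_iff two_ne_zero |>.1 (by linarith : m ^ 2 = 0)
    simp [this]
  · field_simp
    linear_combination -m * h2

theorem mul_abs_gramSlope_le (m s : ℝ) (hs : 0 < s) : s * |gramSlope m s| ≤ |m| := by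
  have h0 : 0 < s + √(s ^ 2 + 4 * m ^ 2) := by positivity
  have h1 := (le_abs_self s).trans (abs_le_sqrt_gram m s)
  have h2 : |gramSlope m s| * (s + √(s ^ 2 + 4 * m ^ 2)) = 2 * |m| := by
    rw [gramSlope, abs_div, abs_of_pos h0, abs_mul, abs_two]
    field_simp
  nlinarith [abs_nonneg (gramSlope m s)]

theorem differentiableAt_gramSlope {m s : ℝ → ℝ} {x : ℝ} (hm : DifferentiableAt ℝ m x)
    (hs : DifferentiableAt ℝ s x) (hpos : 0 < s x) :
    DifferentiableAt ℝ (fun t => gramSlope (m t) (s t)) x := by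
  unfold gramSlope
  refine (hm.const_mul 2).div (hs.add (((hs.pow 2).add ((hm.pow 2).const_mul 4)).sqrt ?_)) ?_
  · exact (show 0 < s x ^ 2 + 4 * m x ^ 2 by positivity).ne'
  · exact (show 0 < s x + √(s x ^ 2 + 4 * m x ^ 2) by positivity).ne'

theorem deriv_gramSlope_mul {m s : ℝ → ℝ} {x m' s' : ℝ} (hm : HasDerivAt m m' x)
    (hs : HasDerivAt s s' x) (hpos : 0 < s x) :
    deriv (fun t => gramSlope (m t) (s t)) x * √(s x ^ 2 + 4 * m x ^ 2) =
      m' * (1 - gramSlope (m x) (s x) ^ 2) - s' * gramSlope (m x) (s x) := by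
  have hq := (differentiableAt_gramSlope hm.differentiableAt hs.differentiableAt hpos).hasDerivAt
  set q' := deriv (fun t => gramSlope (m t) (s t)) x
  have h := ((hm.mul (hq.pow 2)).add (hs.mul hq)).sub hm
  have h0 : HasDerivAt (fun _ : ℝ => (0 : ℝ)) 0 x := hasDerivAt_const x 0
  have h1 := h.unique (h0.congr_of_eventuallyEq
    (Filter.Eventually.of_forall fun t => gramSlope_quadratic (m t) (s t)))
  rw [← two_mul_mul_gramSlope _ _ hpos]
  simp at h1
  linear_combination h1

theorem small_parameter_bounds {P c t : ℝ} (hP : 1 ≤ P) (hc : 0 < c) (hc1 : c ≤ 1) (ht : 0 < t)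
    (htP : 20000 * P ^ 4 * t = c ^ 4) :
    P * t ≤ P ∧ P ^ 2 * t ^ 2 ≤ P ^ 2 * t ∧ 20000 * (P ^ 2 * t) ≤ c ^ 2 ∧
      20000 * (P * t) ≤ c := by
  have hP1 : P ≤ P ^ 2 := le_self_pow₀ hP two_ne_zero
  have hP2 : P ^ 2 ≤ P ^ 4 := pow_le_pow_right₀ hP (by norm_num)
  have hc2 : c ^ 2 ≤ c := pow_le_of_le_one hc.le hc1 two_ne_zero
  have hc4 : c ^ 4 ≤ c ^ 2 := pow_le_pow_of_le_one hc.le hc1 (by norm_num)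
  have h2 : P ^ 2 * t ≤ P ^ 4 * t := by gcongr
  have h1 : P * t ≤ P ^ 2 * t := by gcongr
  have h0 : 1 * t ≤ P * t := by gcongr
  have ht1 : t ≤ 1 := by linarith
  refine ⟨mul_le_of_le_one_right (by linarith) ht1, ?_, by linarith, by linarith⟩
  have : t ^ 2 ≤ t := pow_le_of_le_one ht.le ht1 two_ne_zero
  gcongr

/-- The lower bound for the derivative `q'` of the slope, when the first column `(A, B)` of the
matrix and the second row are small; primes denote derivatives of the entries. -/
theorem abs_deriv_slope_lower_bound {P c t A B C D A' B' C' D' q' : ℝ} (hP : 1 ≤ P) (hc : 0 < c)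
    (hc1 : c ≤ 1) (ht : 0 < t) (htP : 20000 * P ^ 4 * t = c ^ 4)
    (hA : |A| ≤ 2 * P * t) (hB : |B| ≤ P * t) (hD : |D| ≤ P * t) (hC : |C| ≤ 2 * P)
    (hC0 : c / 2 ≤ |C|) (hA0 : c / 2 ≤ |A'|) (hA' : |A'| ≤ 2 * P) (hC' : |C'| ≤ 2 * P)
    (hB' : |B'| ≤ P * t) (hD' : |D'| ≤ P * t) (hs : c ^ 2 / 8 ≤ C ^ 2 + D ^ 2 - A ^ 2 - B ^ 2)
    (hq' : q' * √((C ^ 2 + D ^ 2 - A ^ 2 - B ^ 2) ^ 2 + 4 * (A * C + B * D) ^ 2) =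
      (A' * C + A * C' + (B' * D + B * D')) *
        (1 - gramSlope (A * C + B * D) (C ^ 2 + D ^ 2 - A ^ 2 - B ^ 2) ^ 2) -
      (2 * C * C' + 2 * D * D' - 2 * A * A' - 2 * B * B') *
        gramSlope (A * C + B * D) (C ^ 2 + D ^ 2 - A ^ 2 - B ^ 2)) :
    c ^ 2 / (150 * P ^ 2) ≤ |q'| := by
  obtain ⟨hPP, ht2, hPt, -⟩ := small_parameter_bounds hP hc hc1 ht htP
  have hcp : 0 < c ^ 2 := pow_pos hc 2
  have hc2 : c ^ 2 ≤ 1 := pow_le_one₀ hc.le hc1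
  have hP2 : 1 ≤ P ^ 2 := one_le_pow₀ hP
  have mb {x y X Y : ℝ} (hx : |x| ≤ X) (hy : |y| ≤ Y) : |x * y| ≤ X * Y := by
    rw [abs_mul]; exact mul_le_mul hx hy (abs_nonneg _) ((abs_nonneg _).trans hx)
  set m := A * C + B * D
  set s := C ^ 2 + D ^ 2 - A ^ 2 - B ^ 2 with hsdef
  have hs0 : 0 < s := lt_of_lt_of_le (by positivity) hs
  have hm : |m| ≤ 5 * (P ^ 2 * t) := by
    have := abs_add_le (A * C) (B * D)
    have := mb hA hC
    have := mb hB hD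
    linarith
  have hsP : s ≤ 5 * P ^ 2 := by
    have h1 : C ^ 2 ≤ (2 * P) ^ 2 := sq_le_sq' (abs_le.1 hC).1 (abs_le.1 hC).2
    have h2 : D ^ 2 ≤ P ^ 2 := by
      have := hD.trans hPP
      exact sq_le_sq' (abs_le.1 this).1 (abs_le.1 this).2
    linarith [sq_nonneg A, sq_nonneg B]
  set q := gramSlope m s
  have hq : |q| ≤ c ^ 2 / P ^ 2 / 500 := by
    have h1 := mul_abs_gramSlope_le m s hs0
    have h2 : c ^ 2 / 8 * |q| ≤ 5 * (P ^ 2 * t) := by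
      have := mul_le_mul_of_nonneg_right hs (abs_nonneg q)
      linarith
    have h3 : c ^ 2 * (P ^ 2 * |q|) ≤ c ^ 2 * (c ^ 2 / 500) := by
      linarith [mul_le_mul_of_nonneg_left h2 (by positivity : 0 ≤ 8 * P ^ 2)]
    have h4 := le_of_mul_le_mul_left h3 (by positivity)
    rw [div_div, le_div_iff₀ (by positivity)]
    linarith
  have hqP : P ^ 2 * |q| ≤ c ^ 2 / 500 := by
    calc P ^ 2 * |q| ≤ P ^ 2 * (c ^ 2 / P ^ 2 / 500) := by gcongr
      _ = c ^ 2 / 500 := by field_simp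
  have hq2 : q ^ 2 ≤ 1 / 100 := by
    have h1 : 1 * |q| ≤ P ^ 2 * |q| := by gcongr
    have h2 : |q| ^ 2 ≤ (1 / 10) ^ 2 := by gcongr; linarith
    rw [← sq_abs]; linarith
  set m' := A' * C + A * C' + (B' * D + B * D')
  have hm' : c ^ 2 / 5 ≤ |m'| := by
    have h1 : c / 2 * (c / 2) ≤ |A' * C| := by
      rw [abs_mul]; gcongr
    have h2 := mb hA hC'
    have h3 := mb hB' hD
    have h4 := mb hB hD'
    have h5 : |A' * C| ≤ |m'| + |A * C'| + |B' * D| + |B * D'| := by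
      have e : A' * C = m' - A * C' - B' * D - B * D' := by simp only [m']; ring
      rw [e]
      have := abs_sub (m' - A * C' - B' * D) (B * D')
      have := abs_sub (m' - A * C') (B' * D)
      have := abs_sub m' (A * C')
      linarith
    linarith
  set s' := 2 * C * C' + 2 * D * D' - 2 * A * A' - 2 * B * B'
  have hs' : |s'| ≤ 20 * P ^ 2 := by
    have h1 := abs_le.1 (mb hC hC')
    have h2 := abs_le.1 (mb (hD.trans hPP) (hD'.trans hPP))
    have h3 := abs_le.1 (mb (hA.trans (by linarith : 2 * P * t ≤ 2 * P)) hA')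
    have h4 := abs_le.1 (mb (hB.trans hPP) (hB'.trans hPP))
    rw [abs_le]
    constructor <;> simp only [s'] <;> linarith
  set R := √(s ^ 2 + 4 * m ^ 2)
  have hR0 : 0 < R := Real.sqrt_pos.2 (by positivity)
  have hR : R ≤ 15 * P ^ 2 := by
    refine Real.sqrt_le_iff.2 ⟨by positivity, ?_⟩
    have h1 : |m| ≤ 5 * P ^ 2 := by linarith
    have h2 : m ^ 2 ≤ (5 * P ^ 2) ^ 2 := sq_le_sq' (abs_le.1 h1).1 (abs_le.1 h1).2
    have h3 : s ^ 2 ≤ (5 * P ^ 2) ^ 2 := pow_le_pow_left₀ hs0.le hsP 2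
    linarith [sq_nonneg (P ^ 2)]
  have hnum : c ^ 2 / 10 ≤ |q'| * R := by
    rw [← abs_of_pos hR0, ← abs_mul, hq']
    have h1 := abs_sub_abs_le_abs_sub (m' * (1 - q ^ 2)) (s' * q)
    have h2 : c ^ 2 / 5 * (99 / 100) ≤ |m' * (1 - q ^ 2)| := by
      rw [abs_mul, abs_of_nonneg (by linarith : 0 ≤ 1 - q ^ 2)]
      gcongr
      linarith
    have h3 : |s' * q| ≤ 20 * P ^ 2 * |q| := by
      rw [abs_mul]; gcongr
    linarith
  rw [div_le_iff₀ (by positivity)]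
  linarith [mul_le_mul_of_nonneg_left hR (abs_nonneg q')]

theorem slopeQ_eq_gramSlope (F u v : ℝ × ℝ → ℝ) (b : ℝ) (z : ℝ × ℝ) :
    slopeQ F u v b z =
      gramSlope (DTmat F u v b z 0 0 * DTmat F u v b z 0 1 +
        DTmat F u v b z 1 0 * DTmat F u v b z 1 1)
        (DTmat F u v b z 0 1 ^ 2 + DTmat F u v b z 1 1 ^ 2 - DTmat F u v b z 0 0 ^ 2 -
          DTmat F u v b z 1 0 ^ 2) := by
  unfold slopeQ
  generalize DTmat F u v b z = M
  rw [sq_add_sq_sub_lamMin2_sq, gramSlope, div_div_eq_mul_div, mul_comm (_ + _) (2 : ℝ)]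

theorem hasDerivAt_fderiv_apply {f : ℝ × ℝ → ℝ} (hf : ContDiff ℝ 2 f) (z w : ℝ × ℝ) :
    HasDerivAt (fun x : ℝ => fderiv ℝ f (x, z.2) w) (fderiv ℝ (fderiv ℝ f) z (1, 0) w) z.1 := by
  have h1 : HasFDerivAt (fderiv ℝ f) (fderiv ℝ (fderiv ℝ f) z) (z.1, z.2) :=
    ((hf.fderiv_right (m := 1) (by norm_num)).differentiable (by norm_num) z).hasFDerivAt
  have h2 : HasDerivAt (fun x : ℝ => (x, z.2)) ((1 : ℝ), (0 : ℝ)) z.1 :=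
    (hasDerivAt_id z.1).prodMk (hasDerivAt_const z.1 z.2)
  have h3 : HasFDerivAt (fun L : ℝ × ℝ →L[ℝ] ℝ => L w) (ContinuousLinearMap.apply ℝ ℝ w)
      (fderiv ℝ f (z.1, z.2)) := (ContinuousLinearMap.apply ℝ ℝ w).hasFDerivAt
  exact h3.comp_hasDerivAt z.1 (h1.comp_hasDerivAt z.1 h2)

/-- Lemma 2.9: near a point where `|F_y| ≥ c₀`, `|F_{xx}| ≥ c₀` and `|F_x| ≤ δ`,
the slope `q₁` of the most contracted direction of `DT` is well defined
(denominator `≥ 1/K`), differentiable in `x`, and `|∂_x q₁| ≥ 1/K` at the point. -/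
theorem stmt15 :
    ∀ C₀ c₀ : ℝ, 1 ≤ C₀ → 0 < c₀ → c₀ ≤ 1 →
    ∃ K b₀ δ₀ : ℝ, 1 ≤ K ∧ 0 < b₀ ∧ 0 < δ₀ ∧
      ∀ F u v : ℝ × ℝ → ℝ,
        ContDiff ℝ 2 F → ContDiff ℝ 2 u → ContDiff ℝ 2 v →
        (∀ z : ℝ × ℝ, ∀ w ∈ ({(1, 0), (0, 1)} : Set (ℝ × ℝ)),
          |fderiv ℝ F z w| ≤ C₀ ∧ |fderiv ℝ u z w| ≤ C₀ ∧ |fderiv ℝ v z w| ≤ C₀ ∧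
          ∀ w' ∈ ({(1, 0), (0, 1)} : Set (ℝ × ℝ)),
            |fderiv ℝ (fderiv ℝ F) z w w'| ≤ C₀ ∧
            |fderiv ℝ (fderiv ℝ u) z w w'| ≤ C₀ ∧
            |fderiv ℝ (fderiv ℝ v) z w w'| ≤ C₀) →
      ∀ b : ℝ, 0 < b → b < b₀ →
      ∀ δ : ℝ, 0 < δ → δ ≤ δ₀ →
      ∀ z : ℝ × ℝ,
        c₀ ≤ |fderiv ℝ F z (0, 1)| →
        c₀ ≤ |fderiv ℝ (fderiv ℝ F) z (1, 0) (1, 0)| →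
        |fderiv ℝ F z (1, 0)| ≤ δ →
        ∃ ε : ℝ, 0 < ε ∧
          (∀ w ∈ Metric.ball z ε,
            1 / K ≤ DTmat F u v b w 0 1 ^ 2 + DTmat F u v b w 1 1 ^ 2 -
                lamMin2 (DTmat F u v b w) ^ 2 ∧
            DifferentiableAt ℝ (fun x : ℝ => slopeQ F u v b (x, w.2)) w.1) ∧
          1 / K ≤ |deriv (fun x : ℝ => slopeQ F u v b (x, z.2)) z.1| := by
  intro P c hP hc hc1
  have hP2 : 1 ≤ P ^ 2 := one_le_pow₀ hP
  have hc2 : c ^ 2 ≤ 1 := pow_le_one₀ hc.le hc1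
  set t := c ^ 4 / (20000 * P ^ 4) with htdef
  have ht : 0 < t := by positivity
  have htP : 20000 * P ^ 4 * t = c ^ 4 := by rw [htdef]; field_simp
  obtain ⟨hPP, ht2, hPt, hPtc⟩ := small_parameter_bounds hP hc hc1 ht htP
  refine ⟨150 * P ^ 2 / c ^ 2, t, t, ?_, ht, ht, ?_⟩
  · rw [le_div_iff₀ (by positivity)]; linarith
  intro F u v hF hu hv hbd b hb hbt δ _ hδt z hFy hFxx hFx
  rw [one_div_div]
  have hdA (w : ℝ × ℝ) : HasDerivAt (fun x : ℝ => DTmat F u v b (x, w.2) 0 0) _ w.1 :=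
    (hasDerivAt_fderiv_apply hF w (1, 0)).add ((hasDerivAt_fderiv_apply hu w (1, 0)).const_mul b)
  have hdC (w : ℝ × ℝ) : HasDerivAt (fun x : ℝ => DTmat F u v b (x, w.2) 0 1) _ w.1 :=
    (hasDerivAt_fderiv_apply hF w (0, 1)).add ((hasDerivAt_fderiv_apply hu w (0, 1)).const_mul b)
  have hdB (w : ℝ × ℝ) : HasDerivAt (fun x : ℝ => DTmat F u v b (x, w.2) 1 0) _ w.1 :=
    (hasDerivAt_fderiv_apply hv w (1, 0)).const_mul b
  have hdD (w : ℝ × ℝ) : HasDerivAt (fun x : ℝ => DTmat F u v b (x, w.2) 1 1) _ w.1 :=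
    (hasDerivAt_fderiv_apply hv w (0, 1)).const_mul b
  have hdm (w : ℝ × ℝ) := ((hdA w).mul (hdC w)).add ((hdB w).mul (hdD w))
  have hds (w : ℝ × ℝ) :=
    ((((hdC w).pow 2).add ((hdD w).pow 2)).sub ((hdA w).pow 2)).sub ((hdB w).pow 2)
  have hcont (i j : Fin 2) : Continuous fun w => DTmat F u v b w i j := by
    have hc' {f : ℝ × ℝ → ℝ} (hf : ContDiff ℝ 2 f) (e : ℝ × ℝ) :
        Continuous fun w => fderiv ℝ f w e :=
      (hf.continuous_fderiv (by norm_num)).clm_apply continuous_const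
    fin_cases i <;> fin_cases j
    · exact (hc' hF (1, 0)).add ((hc' hu (1, 0)).const_mul b)
    · exact (hc' hF (0, 1)).add ((hc' hu (0, 1)).const_mul b)
    · exact (hc' hv (1, 0)).const_mul b
    · exact (hc' hv (0, 1)).const_mul b
  have hbb {y : ℝ} (hy : |y| ≤ P) : |b * y| ≤ P * t := by
    rw [abs_mul, abs_of_pos hb, mul_comm]; gcongr
  have hup {x y X : ℝ} (hx : |x| ≤ X) (hy : |y| ≤ P) : |x + b * y| ≤ X + P * t :=
    (abs_add_le _ _).trans (add_le_add hx (hbb hy))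
  have hlow {x y : ℝ} (hx : c ≤ |x|) (hy : |y| ≤ P) : c / 2 ≤ |x + b * y| := by
    have h1 := hbb hy
    have h2 := abs_sub_abs_le_abs_sub x (-(b * y))
    rw [abs_neg, sub_neg_eq_add] at h2
    linarith
  obtain ⟨-, hux, hvx, hx⟩ := hbd z (1, 0) (by simp)
  obtain ⟨hFy', huy, hvy, -⟩ := hbd z (0, 1) (by simp)
  obtain ⟨hFxx', huxx, hvxx⟩ := hx (1, 0) (by simp)
  obtain ⟨hFxy, huxy, hvxy⟩ := hx (0, 1) (by simp)
  have hA : |DTmat F u v b z 0 0| ≤ 2 * P * t :=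
    (hup hFx hux).trans (by linarith [le_mul_of_one_le_left ht.le hP])
  have hC : |DTmat F u v b z 0 1| ≤ 2 * P := (hup hFy' huy).trans (by linarith)
  have hB : |DTmat F u v b z 1 0| ≤ P * t := hbb hvx
  have hD : |DTmat F u v b z 1 1| ≤ P * t := hbb hvy
  have hC0 : c / 2 ≤ |DTmat F u v b z 0 1| := hlow hFy huy
  set s : ℝ × ℝ → ℝ := fun w => DTmat F u v b w 0 1 ^ 2 + DTmat F u v b w 1 1 ^ 2 -
    DTmat F u v b w 0 0 ^ 2 - DTmat F u v b w 1 0 ^ 2 with hs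
  have hscont : Continuous s :=
    ((((hcont 0 1).pow 2).add ((hcont 1 1).pow 2)).sub ((hcont 0 0).pow 2)).sub ((hcont 1 0).pow 2)
  have hsz : c ^ 2 / 8 ≤ s z := by
    have h1 : (c / 2) ^ 2 ≤ DTmat F u v b z 0 1 ^ 2 := by
      rw [← sq_abs (DTmat F u v b z 0 1)]; gcongr
    have h2 : DTmat F u v b z 0 0 ^ 2 ≤ (2 * P * t) ^ 2 :=
      sq_le_sq' (abs_le.1 hA).1 (abs_le.1 hA).2
    have h3 : DTmat F u v b z 1 0 ^ 2 ≤ (P * t) ^ 2 :=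
      sq_le_sq' (abs_le.1 hB).1 (abs_le.1 hB).2
    simp only [hs]
    linarith [sq_nonneg (DTmat F u v b z 1 1), pow_pos hc 2]
  obtain ⟨ε, hε, hball⟩ := Metric.eventually_nhds_iff_ball.1
    (hscont.continuousAt.eventually (lt_mem_nhds
      (show c ^ 2 / 16 < s z by linarith [pow_pos hc 2])))
  simp only [slopeQ_eq_gramSlope, sq_add_sq_sub_lamMin2_sq]
  refine ⟨ε, hε, fun w hw => ⟨?_, ?_⟩, ?_⟩
  · have h1 : c ^ 2 / 16 < s w := hball w hw
    have h2 := (le_abs_self _).trans (abs_le_sqrt_gram (DTmat F u v b w 0 0 * DTmat F u v b w 0 1 +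
      DTmat F u v b w 1 0 * DTmat F u v b w 1 1) (s w))
    have h3 : c ^ 2 / (150 * P ^ 2) ≤ c ^ 2 / 16 := by gcongr; linarith
    linarith
  · exact differentiableAt_gramSlope (hdm w).differentiableAt (hds w).differentiableAt
      (lt_trans (by positivity) (hball w hw))
  · have hq := deriv_gramSlope_mul (hdm z) (hds z) (lt_of_lt_of_le (by positivity) hsz)
    refine abs_deriv_slope_lower_bound hP hc hc1 ht htP hA hB hD hC hC0 (hlow hFxx huxx)
      ((hup hFxx' huxx).trans (by linarith)) ((hup hFxy huxy).trans (by linarith)) (hbb hvxx)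
      (hbb hvxy) hsz ?_
    refine hq.trans ?_
    simp
end

section
/- Let n ≥ 1 and let A : Fin n → Fin n → Prop be a transition relation such that every a ∈ Fin n has at least one successor (∀ a, ∃ a′, A a a′). Let X := { x : ℕ → Fin n | ∀ i, A (x i) (x (i+1)) } be the associated one-sided subshift of finite type, topologized as a subspace of the product space (Fin n)^ℕ (with Fin n discrete), and let σ : X → X be the shift map, (σ x)(i) = x(i+1). Then the set of points of X that are preperiodic under σ — i.e. points x for which there exist m ≥ 0 and p ≥ 1 with σ^{m+p}(x) = σ^m(x) — is dense in X. -/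
/-- The shift map on the one-sided subshift of finite type determined by the
transition relation `A` : it sends `(x 0, x 1, x 2, …)` to `(x 1, x 2, x 3, …)`. -/
def shiftSFT {n : ℕ} (A : Fin n → Fin n → Prop)
    (x : {x : ℕ → Fin n // ∀ i, A (x i) (x (i + 1))}) :
    {x : ℕ → Fin n // ∀ i, A (x i) (x (i + 1))} :=
  ⟨fun i => x.1 (i + 1), fun i => x.2 (i + 1)⟩

theorem shiftSFT_iterate_apply {n : ℕ} (A : Fin n → Fin n → Prop) (k : ℕ)
    (x : {x : ℕ → Fin n // ∀ i, A (x i) (x (i + 1))}) (i : ℕ) :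
    ((shiftSFT A)^[k] x).1 i = x.1 (i + k) := by
  induction k generalizing x with
  | zero => rfl
  | succ k ih =>
    rw [Function.iterate_succ_apply, ih]
    rfl

/-- The point that follows `x` up to time `N` and then the orbit of `x N` under the
successor function `f`. -/
def followThenIterate {n : ℕ} {A : Fin n → Fin n → Prop} (f : Fin n → Fin n)
    (hf : ∀ a, A a (f a)) (x : {x : ℕ → Fin n // ∀ i, A (x i) (x (i + 1))}) (N : ℕ) :
    {x : ℕ → Fin n // ∀ i, A (x i) (x (i + 1))} :=
  ⟨fun i => f^[i - N] (x.1 (min i N)), fun i => by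
    beta_reduce
    rcases lt_or_ge i N with h | h
    · have h₁ : i - N = 0 := by omega
      have h₂ : i + 1 - N = 0 := by omega
      rw [h₁, h₂, min_eq_left h.le, min_eq_left (Nat.succ_le_of_lt h)]
      exact x.2 i
    · rw [Nat.sub_add_comm h, min_eq_right h, min_eq_right (h.trans i.le_succ),
        Function.iterate_succ_apply']
      exact hf _⟩

theorem followThenIterate_preperiodic {n : ℕ} {A : Fin n → Fin n → Prop} (f : Fin n → Fin n)
    (hf : ∀ a, A a (f a)) (x : {x : ℕ → Fin n // ∀ i, A (x i) (x (i + 1))}) (N : ℕ) :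
    ∃ m p : ℕ, 1 ≤ p ∧ (shiftSFT A)^[m + p] (followThenIterate f hf x N) =
      (shiftSFT A)^[m] (followThenIterate f hf x N) := by
  obtain ⟨a, b, hab, h⟩ : ∃ a b : ℕ, a < b ∧ f^[a] (x.1 N) = f^[b] (x.1 N) := by
    obtain ⟨a, b, hne, h⟩ :=
      Finite.exists_ne_map_eq_of_infinite (fun k : ℕ => f^[k] (x.1 N))
    rcases hne.lt_or_gt with hlt | hlt
    · exact ⟨a, b, hlt, h⟩
    · exact ⟨b, a, hlt, h.symm⟩
  refine ⟨N + a, b - a, by omega, Subtype.ext (funext fun i => ?_)⟩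
  rw [shiftSFT_iterate_apply, shiftSFT_iterate_apply]
  simp only [followThenIterate]
  have h₁ : i + (N + a + (b - a)) - N = i + b := by omega
  have h₂ : i + (N + a) - N = i + a := by omega
  rw [h₁, h₂, min_eq_right (by omega), min_eq_right (by omega),
    Function.iterate_add_apply, Function.iterate_add_apply, h]

theorem tendsto_followThenIterate {n : ℕ} {A : Fin n → Fin n → Prop} (f : Fin n → Fin n)
    (hf : ∀ a, A a (f a)) (x : {x : ℕ → Fin n // ∀ i, A (x i) (x (i + 1))}) :
    Filter.Tendsto (followThenIterate f hf x) Filter.atTop (nhds x) := by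
  rw [tendsto_subtype_rng, tendsto_pi_nhds]
  intro i
  refine tendsto_const_nhds.congr' ?_
  filter_upwards [Filter.eventually_ge_atTop i] with N hN
  simp [followThenIterate, Nat.sub_eq_zero_of_le hN, min_eq_left hN]

/-- Preperiodic points are dense in a one-sided subshift of finite type in which
every symbol has a successor.  The subshift carries the topology induced from the
product topology on `(Fin n)^ℕ` (with `Fin n` discrete). -/
theorem stmt16 (n : ℕ) (hn : 1 ≤ n) (A : Fin n → Fin n → Prop)
    (hA : ∀ a : Fin n, ∃ a' : Fin n, A a a') :
    Dense {x : {x : ℕ → Fin n // ∀ i, A (x i) (x (i + 1))} |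
      ∃ m p : ℕ, 1 ≤ p ∧ (shiftSFT A)^[m + p] x = (shiftSFT A)^[m] x} := by
  choose f hf using hA
  intro x
  exact mem_closure_of_tendsto (tendsto_followThenIterate f hf x)
    (Filter.Eventually.of_forall (followThenIterate_preperiodic f hf x))
end
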